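/- For any δ > 0 there exist ε = ε(δ) > 0, η = η(δ) > 0 and A = A(δ) > 0 with the following property. Let μ be a 3-asymptotically optimally doubling Radon measure on ℝ⁴ whose support Σ has 0 as a nonflat point, and let r₀ > 0 satisfy: ϑ^C_Σ(x,r) < ε for all x ∈ Σ ∩ B(0,r₀) and 0 < r ≤ r₀, and θ^C_Σ(0,r) < η for all 0 < r ≤ r₀. Then θ^P_Σ(x,r) < δ for all x ∈ Σ ∩ B(0, 2r₀/3) with x ≠ 0 and all 0 < r < |x|/A. -/

import Mathlib

open Metric Set MeasureTheory Filter Module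
open scoped RealInnerProductSpace Topology Pointwise ENNReal

noncomputable section

/-- `ℝⁿ` as a Euclidean space. -/
abbrev E (n : ℕ) : Type := EuclideanSpace ℝ (Fin n)

/-- `d(A,B) = sup_{a ∈ A} inf_{b ∈ B} |a - b|`. -/
def setD {n : ℕ} (A B : Set (E n)) : ℝ := ⨆ a ∈ A, Metric.infDist a B

/-- `d^{x,r}(A,B) = (1/r) d(A ∩ B(x,r), B ∩ B(x,r))`. -/
def dxr {n : ℕ} (x : E n) (r : ℝ) (A B : Set (E n)) : ℝ :=
  (1 / r) * setD (A ∩ closedBall x r) (B ∩ closedBall x r)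

/-- `D^{x,r}(A,B) = max(d^{x,r}(A,B), d^{x,r}(B,A))`. -/
def Dxr {n : ℕ} (x : E n) (r : ℝ) (A B : Set (E n)) : ℝ :=
  max (dxr x r A B) (dxr x r B A)

/-- `d̃^{x,r}(A,B) = (1/r) d(A ∩ B(x,r), B)`. -/
def dtxr {n : ℕ} (x : E n) (r : ℝ) (A B : Set (E n)) : ℝ :=
  (1 / r) * setD (A ∩ closedBall x r) B

/-- `D̃^{x,r}(A,B) = max(d̃^{x,r}(A,B), d̃^{x,r}(B,A))`. -/
def Dtxr {n : ℕ} (x : E n) (r : ℝ) (A B : Set (E n)) : ℝ :=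
  max (dtxr x r A B) (dtxr x r B A)

/-- `C` is a cone based at `y`: `y ∈ C` and `s • (C − y) = C − y` for all `s > 0`. -/
def IsConeAt {n : ℕ} (y : E n) (C : Set (E n)) : Prop :=
  y ∈ C ∧ ∀ s : ℝ, 0 < s → s • {z : E n | y + z ∈ C} = {z : E n | y + z ∈ C}

/-- The standard KP cone `{x₄² = x₁² + x₂² + x₃²}` in `ℝⁿ`, `n ≥ 4`. -/
def stdKP (n : ℕ) (hn : 4 ≤ n) : Set (E n) :=
  {x : E n | (x ⟨3, by omega⟩) ^ 2 =
    (x ⟨0, by omega⟩) ^ 2 + (x ⟨1, by omega⟩) ^ 2 + (x ⟨2, by omega⟩) ^ 2}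

/-- `C` is a KP cone based at `y`: in some orthonormal coordinates centered at the origin,
`C − y` is the standard KP cone. -/
def IsKPCone {n : ℕ} (hn : 4 ≤ n) (y : E n) (C : Set (E n)) : Prop :=
  ∃ f : E n ≃ₗᵢ[ℝ] E n, {z : E n | y + z ∈ C} = f ⁻¹' stdKP n hn

/-- `θ^P_Σ(x,r)` : best approximation of `S` in `B(x,r)` by affine `m`-planes through `x`. -/
def thetaP {n : ℕ} (m : ℕ) (S : Set (E n)) (x : E n) (r : ℝ) : ℝ :=
  ⨅ L : {L : AffineSubspace ℝ (E n) // x ∈ L ∧ Module.finrank ℝ L.direction = m},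
    Dxr x r S (L.1 : Set (E n))

/-- `θ^C_Σ(x,r)` : best approximation of `S` in `B(x,r)` by KP cones based at `x`. -/
def thetaC {n : ℕ} (hn : 4 ≤ n) (S : Set (E n)) (x : E n) (r : ℝ) : ℝ :=
  ⨅ C : {C : Set (E n) // IsKPCone hn x C}, Dxr x r S C.1

/-- `ϑ^C_Σ(x,r)` : best approximation of `S` in `B(x,r)` by KP cones containing `x`. -/
def varthetaC {n : ℕ} (hn : 4 ≤ n) (S : Set (E n)) (x : E n) (r : ℝ) : ℝ :=
  ⨅ C : {C : Set (E n) // (∃ y, IsKPCone hn y C) ∧ x ∈ C}, Dxr x r S C.1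

/-- The angle `∠(P₁,P₂) = arcsin Γ(P₁,P₂)` between two affine planes. -/
def planeAngle {n : ℕ} (P₁ P₂ : AffineSubspace ℝ (E n)) : ℝ :=
  Real.arcsin (dxr (0 : E n) 1 (P₁.direction : Set (E n)) (P₂.direction : Set (E n)))

/-- The support of a measure. -/
def msupp {n : ℕ} (μ : Measure (E n)) : Set (E n) :=
  {x : E n | ∀ r : ℝ, 0 < r → 0 < μ (closedBall x r)}

/-- Weak convergence of a sequence of measures in the sense of Radon measures. -/
def VagueTendsto {n : ℕ} (μs : ℕ → Measure (E n)) (ν : Measure (E n)) : Prop :=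
  ∀ f : E n → ℝ, Continuous f → HasCompactSupport f →
    Tendsto (fun i => ∫ y, f y ∂(μs i)) atTop (nhds (∫ y, f y ∂ν))

/-- `ν` is a tangent measure of `μ` at `x`: `ν ≠ 0` and for some `rᵢ ↓ 0`, `cᵢ > 0`,
`cᵢ (T_{x,rᵢ})₊μ → ν` weakly. -/
def IsTangentMeasure {n : ℕ} (μ ν : Measure (E n)) (x : E n) : Prop :=
  ν ≠ 0 ∧ ∃ r c : ℕ → ℝ, (∀ i, 0 < r i) ∧ Tendsto r atTop (nhds 0) ∧ (∀ i, 0 < c i) ∧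
    VagueTendsto (fun i => ENNReal.ofReal (c i) • Measure.map (fun y => (r i)⁻¹ • (y - x)) μ) ν

/-- `μ` is `m`-asymptotically optimally doubling. -/
def AOD {n : ℕ} (m : ℕ) (μ : Measure (E n)) : Prop :=
  ∀ K : Set (E n), K ⊆ msupp μ → IsCompact K → ∀ δ : ℝ, 0 < δ →
    ∃ r₀ : ℝ, 0 < r₀ ∧ ∀ x ∈ K, ∀ r : ℝ, 0 < r → r ≤ r₀ →
      ∀ τ : ℝ, τ ∈ Set.Icc (1/2 : ℝ) 1 →
        |(μ (closedBall x (τ * r))).toReal / (μ (closedBall x r)).toReal - τ ^ m| < δ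

/-- `ν` is `m`-flat: `m`-dimensional Hausdorff measure restricted to an affine `m`-plane. -/
def IsFlatMeasure {n : ℕ} (m : ℕ) (ν : Measure (E n)) : Prop :=
  ∃ L : AffineSubspace ℝ (E n), (L : Set (E n)).Nonempty ∧
    Module.finrank ℝ L.direction = m ∧
    ν = (Measure.hausdorffMeasure (m : ℝ)).restrict (L : Set (E n))

/-- Volume of the unit ball in `ℝᵐ`. -/
def unitBallVol (m : ℕ) : ℝ := (volume (Metric.ball (0 : EuclideanSpace ℝ (Fin m)) 1)).toReal

/-- `ω₃`, the volume of the unit `3`-ball. -/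
def omega3 : ℝ := unitBallVol 3

/-- The second moment `Q_{0,r}` of a measure on `ℝ⁴`. -/
def Qmom (μ : Measure (E 4)) (r : ℝ) (z : E 4) : ℝ :=
  (5 / (omega3 * r ^ 5)) * ∫ w in closedBall (0 : E 4) r, ⟪z, w⟫ ^ 2 ∂μ

/-- Entries `q_{ij}` of the second moment matrix in given directions. -/
def qmom (μ : Measure (E 4)) (r : ℝ) (u v : E 4) : ℝ :=
  (5 / (omega3 * r ^ 5)) * ∫ w in closedBall (0 : E 4) r, ⟪u, w⟫ * ⟪v, w⟫ ∂μ

/-- `μ` is `(α,m)`-Hölder asymptotically uniform. -/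
def HolderAsympUniform {n : ℕ} (α : ℝ) (m : ℕ) (μ : Measure (E n)) : Prop :=
  ∀ K : Set (E n), K ⊆ msupp μ → IsCompact K →
    ∃ C r₀ : ℝ, 0 < r₀ ∧ ∀ x ∈ K, ∀ r : ℝ, 0 < r → r ≤ r₀ →
      |(μ (closedBall x r)).toReal / (unitBallVol m * r ^ m) - 1| ≤ C * r ^ α

/-- `φ` is a `C^{1,β}` diffeomorphism from `U` onto `U'`: a continuously differentiable bijection
with `β`-Hölder derivative whose inverse is also `C^{1,β}`. -/
def IsC1HolderDiffeoOn (β : ℝ) (U U' : Set (E 4)) (φ : E 4 → E 4) : Prop :=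
  Set.BijOn φ U U' ∧
  (∀ x ∈ U, HasFDerivAt φ (fderiv ℝ φ x) x) ∧
  (∃ M : ℝ, ∀ x ∈ U, ∀ y ∈ U, ‖fderiv ℝ φ x - fderiv ℝ φ y‖ ≤ M * ‖x - y‖ ^ β) ∧
  ∃ ψ : E 4 → E 4, Set.BijOn ψ U' U ∧
    (∀ x ∈ U, ψ (φ x) = x) ∧ (∀ y ∈ U', φ (ψ y) = y) ∧
    (∀ y ∈ U', HasFDerivAt ψ (fderiv ℝ ψ y) y) ∧
    (∃ M : ℝ, ∀ x ∈ U', ∀ y ∈ U', ‖fderiv ℝ ψ x - fderiv ℝ ψ y‖ ≤ M * ‖x - y‖ ^ β)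

lemma fs_exists_near {x : E 4} {r ε : ℝ} {A B : Set (E 4)} (hr : 0 < r) (hB : x ∈ B)
    (h : dxr x r A B < ε) : ∀ a ∈ A, dist a x ≤ r → ∃ b ∈ B, dist b x ≤ r ∧ dist a b < ε * r := by
  intro a ha har
  have h1 : setD (A ∩ closedBall x r) (B ∩ closedBall x r) < ε * r := by
    unfold dxr at h
    rw [one_div, inv_mul_lt_iff₀ hr] at h
    linarith
  have hx : x ∈ B ∩ closedBall x r := ⟨hB, by simp [hr.le]⟩
  have hle : ∀ a, (⨆ (_ : a ∈ A ∩ closedBall x r), infDist a (B ∩ closedBall x r)) ≤ r := by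
    intro a
    apply Real.iSup_le _ hr.le
    intro ha
    exact (infDist_le_dist_of_mem hx).trans ha.2
  have hbdd : BddAbove (Set.range fun a => ⨆ (_ : a ∈ A ∩ closedBall x r),
      infDist a (B ∩ closedBall x r)) := ⟨r, by rintro _ ⟨a, rfl⟩; exact hle a⟩
  have ham : a ∈ A ∩ closedBall x r := ⟨ha, har⟩
  have h2 : infDist a (B ∩ closedBall x r) < ε * r := by
    refine lt_of_le_of_lt ?_ h1
    have := le_ciSup hbdd a
    simp only [ciSup_pos ham] at this
    exact this
  obtain ⟨b, hb, hab⟩ := (infDist_lt_iff ⟨x, hx⟩).1 h2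
  exact ⟨b, hb.1, hb.2, hab⟩

lemma fs_thetaP_le {S : Set (E 4)} {x n : E 4} {r k : ℝ} (hr : 0 < r) (hk : 0 ≤ k)
    (hn : ‖n‖ = 1)
    (h1 : ∀ a ∈ S, dist a x ≤ r → |⟪n, a - x⟫| ≤ k * r)
    (h2 : ∀ q : E 4, dist q x ≤ r → ⟪n, q - x⟫ = 0 → ∃ b ∈ S, dist b x ≤ r ∧ dist q b ≤ k * r) :
    thetaP 3 S x r ≤ k := by
  have : Fact (finrank ℝ (E 4) = 3 + 1) := ⟨by simp⟩
  have hn0 : n ≠ 0 := by rintro rfl; simp at hn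
  let L : AffineSubspace ℝ (E 4) := AffineSubspace.mk' x (ℝ ∙ n)ᗮ
  have hmem : ∀ q, q ∈ L ↔ ⟪n, q - x⟫ = 0 := by
    intro q
    rw [AffineSubspace.mem_mk', Submodule.mem_orthogonal_singleton_iff_inner_right, vsub_eq_sub]
  have hL : x ∈ L ∧ finrank ℝ L.direction = 3 := by
    refine ⟨AffineSubspace.self_mem_mk' _ _, ?_⟩
    rw [AffineSubspace.direction_mk']
    exact Submodule.finrank_orthogonal_span_singleton hn0
  have hnn : ∀ A B : Set (E 4), 0 ≤ dxr x r A B := by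
    intro A B
    apply mul_nonneg (by positivity)
    apply Real.iSup_nonneg; intro a; apply Real.iSup_nonneg; intro _; exact infDist_nonneg
  have hd : ∀ A B : Set (E 4), (∀ a ∈ A, dist a x ≤ r → ∃ b ∈ B, dist b x ≤ r ∧ dist a b ≤ k * r) →
      dxr x r A B ≤ k := by
    intro A B h
    unfold dxr
    rw [one_div, inv_mul_le_iff₀ hr, mul_comm]
    apply Real.iSup_le _ (by positivity)
    intro a
    apply Real.iSup_le _ (by positivity)
    intro ha
    obtain ⟨b, hb, hbx, hab⟩ := h a ha.1 ha.2
    have hbm : b ∈ B ∩ closedBall x r := ⟨hb, hbx⟩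
    exact (infDist_le_dist_of_mem hbm).trans hab
  have hD : Dxr x r S (L : Set (E 4)) ≤ k := by
    apply max_le
    · apply hd
      intro a ha hax
      have hh : ⟪n, (a - ⟪n, a - x⟫ • n) - x⟫ = 0 := by
        have : (a - ⟪n, a - x⟫ • n) - x = (a - x) - ⟪n, a - x⟫ • n := by abel
        rw [this, inner_sub_right, real_inner_smul_right, real_inner_self_eq_norm_sq, hn]; ring
      refine ⟨a - ⟪n, a - x⟫ • n, (hmem _).2 hh, ?_, ?_⟩
      · refine le_trans ?_ hax
        rw [dist_eq_norm, dist_eq_norm]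
        have h3 : (a - ⟪n, a - x⟫ • n) - x = (a - x) - ⟪n, a - x⟫ • n := by abel
        rw [h3]
        apply le_of_sq_le_sq _ (norm_nonneg _)
        rw [norm_sub_sq_real, real_inner_smul_right, norm_smul, hn, real_inner_comm,
          Real.norm_eq_abs, mul_one, sq_abs]
        rw [real_inner_comm]
        nlinarith [sq_nonneg (⟪n, a - x⟫)]
      · rw [dist_eq_norm, sub_sub_cancel, norm_smul, hn, mul_one, Real.norm_eq_abs]
        exact h1 a ha hax
    · apply hd
      intro q hq hqx
      exact h2 q hqx ((hmem q).1 hq)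
  refine le_trans ?_ hD
  unfold thetaP
  refine ciInf_le (f := fun L : {L : AffineSubspace ℝ (E 4) // x ∈ L ∧
    Module.finrank ℝ L.direction = 3} => Dxr x r S (L.1 : Set (E 4))) ⟨0, ?_⟩ ⟨L, hL⟩
  rintro _ ⟨M, rfl⟩
  exact le_max_of_le_left (hnn _ _)

/-- axis description of a KP cone -/
lemma fs_axis {y : E 4} {C : Set (E 4)} (h : IsKPCone (le_refl 4) y C) :
    ∃ e w : E 4, ‖e‖ = 1 ∧ ‖w‖ = 1 ∧ ⟪e, w⟫ = 0 ∧
      ∀ p, p ∈ C ↔ 2 * ⟪e, p - y⟫ ^ 2 = ‖p - y‖ ^ 2 := by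
  obtain ⟨f, hf⟩ := h
  refine ⟨f.symm (EuclideanSpace.single 3 1), f.symm (EuclideanSpace.single 0 1),
    by simp, by simp, ?_, ?_⟩
  · rw [LinearIsometryEquiv.inner_map_map, EuclideanSpace.inner_single_left]
    simp
  · intro p
    have h1 : p ∈ C ↔ f (p - y) ∈ stdKP 4 (le_refl 4) := by
      have := Set.ext_iff.1 hf (p - y)
      simpa using this
    have h2 : ⟪f.symm (EuclideanSpace.single 3 1), p - y⟫ = (f (p - y)) 3 := by
      rw [← LinearIsometryEquiv.inner_map_map f, LinearIsometryEquiv.apply_symm_apply,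
        EuclideanSpace.inner_single_left]
      simp
    rw [h1, h2, ← f.norm_map (p - y), EuclideanSpace.norm_sq_eq]
    simp only [stdKP, Set.mem_ofPred_eq, Fin.sum_univ_four, Real.norm_eq_abs, sq_abs]
    change (f (p - y)) 3 ^ 2 = (f (p - y)) 0 ^ 2 + (f (p - y)) 1 ^ 2 + (f (p - y)) 2 ^ 2 ↔ _
    constructor <;> intro h <;> linarith

lemma fs_axis_pos {y x : E 4} {C : Set (E 4)} (h : IsKPCone (le_refl 4) y C) :
    ∃ e : E 4, ‖e‖ = 1 ∧ 0 ≤ ⟪e, x - y⟫ ∧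
      ∀ p, p ∈ C ↔ 2 * ⟪e, p - y⟫ ^ 2 = ‖p - y‖ ^ 2 := by
  obtain ⟨e, w, he, -, -, hC⟩ := fs_axis h
  by_cases h0 : 0 ≤ ⟪e, x - y⟫
  · exact ⟨e, he, h0, hC⟩
  · refine ⟨-e, by simpa using he, ?_, ?_⟩
    · rw [inner_neg_left]; linarith
    · intro p; rw [hC, inner_neg_left, neg_sq]

/-- the vertex is far away if the cone is nearly flat -/
lemma fs_vertex_far {y x n : E 4} {C : Set (E 4)} (h : IsKPCone (le_refl 4) y C) {s b : ℝ}
    (hs : 0 < s) (hb : b ≤ 1 / 8) (hn : ‖n‖ = 1)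
    (hc : ∀ c ∈ C, dist c x ≤ s → |⟪n, c - x⟫| ≤ b * s) : s / 2 < dist x y := by
  by_contra hcon
  push Not at hcon
  obtain ⟨e, w, he, hw, hew, hC⟩ := fs_axis h
  obtain ⟨v, α, γ, hv, hev, hnv⟩ : ∃ (v : E 4) (α γ : ℝ), ‖v‖ = 1 ∧ ⟪e, v⟫ = 0 ∧
      n = α • e + γ • v := by
    by_cases hm : n - ⟪e, n⟫ • e = 0
    · exact ⟨w, ⟪e, n⟫, 0, hw, hew, by rw [sub_eq_zero] at hm; simpa using hm⟩
    · have hm' : ‖n - ⟪e, n⟫ • e‖ ≠ 0 := by simpa using hm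
      refine ⟨‖n - ⟪e, n⟫ • e‖⁻¹ • (n - ⟪e, n⟫ • e), ⟪e, n⟫, ‖n - ⟪e, n⟫ • e‖, ?_, ?_, ?_⟩
      · rw [norm_smul, norm_inv, norm_norm, inv_mul_cancel₀ hm']
      · rw [real_inner_smul_right, inner_sub_right, real_inner_smul_right,
          real_inner_self_eq_norm_sq, he]; ring
      · rw [smul_smul, mul_inv_cancel₀ hm']; simp
  have hve : ⟪v, e⟫ = 0 := by rw [real_inner_comm]; exact hev
  have hag : α ^ 2 + γ ^ 2 = 1 := by
    have h1 : ‖n‖ ^ 2 = 1 := by rw [hn]; norm_num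
    rw [hnv, norm_add_sq_real, norm_smul, norm_smul, he, hv, real_inner_smul_left,
      real_inner_smul_right, hev, mul_one, mul_one, Real.norm_eq_abs, Real.norm_eq_abs,
      sq_abs, sq_abs] at h1
    linarith
  have hy : |⟪n, y - x⟫| ≤ b * s := by
    apply hc y ((hC y).2 (by simp))
    rw [dist_comm]; linarith
  have key : ∀ t : ℝ, t ^ 2 = 1 → |s / 3 * (α + t * γ)| ≤ 2 * (b * s) := by
    intro t ht
    have hin : ⟪e, (s / 3) • (e + t • v)⟫ = s / 3 := by
      rw [real_inner_smul_right, inner_add_right, real_inner_smul_right, hev,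
        real_inner_self_eq_norm_sq, he]; ring
    have hno : ‖(s / 3) • (e + t • v)‖ ^ 2 = 2 * (s / 3) ^ 2 := by
      rw [norm_smul, mul_pow, norm_add_sq_real, norm_smul, he, hv, real_inner_smul_right, hev,
        mul_one, Real.norm_eq_abs, Real.norm_eq_abs, sq_abs, sq_abs, ht]; ring
    have hnin : ⟪n, (s / 3) • (e + t • v)⟫ = s / 3 * (α + t * γ) := by
      rw [hnv, real_inner_smul_right, inner_add_right, real_inner_smul_right, inner_add_left,
        inner_add_left, real_inner_smul_left, real_inner_smul_left, real_inner_smul_left,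
        real_inner_smul_left, hev, hve, real_inner_self_eq_norm_sq, real_inner_self_eq_norm_sq,
        he, hv]; ring
    have h1 := hc (y + (s / 3) • (e + t • v)) ((hC _).2 (by
      rw [add_sub_cancel_left, hin, hno])) (by
        have h2 : ‖(s / 3) • (e + t • v)‖ ≤ s / 2 := by
          apply le_of_sq_le_sq _ (by positivity)
          rw [hno]; nlinarith
        calc dist (y + (s / 3) • (e + t • v)) x
            ≤ dist (y + (s / 3) • (e + t • v)) y + dist y x := dist_triangle _ _ _
          _ ≤ s / 2 + s / 2 := by
            gcongr
            · simpa [dist_eq_norm] using h2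
            · rw [dist_comm]; exact hcon
          _ = s := by ring)
    have h3 : y + (s / 3) • (e + t • v) - x = (y - x) + (s / 3) • (e + t • v) := by abel
    rw [h3, inner_add_right, hnin] at h1
    rw [abs_le] at *
    constructor <;> linarith [h1.1, h1.2, hy.1, hy.2]
  have k1 := key 1 (by norm_num)
  have k2 := key (-1) (by norm_num)
  have hbs : 2 * (b * s) ≤ s / 4 := by nlinarith
  have k1' : (s / 3 * (α + 1 * γ)) ^ 2 ≤ (s / 4) ^ 2 := by
    rw [← sq_abs (s / 3 * _)]; gcongr; linarith
  have k2' : (s / 3 * (α + -1 * γ)) ^ 2 ≤ (s / 4) ^ 2 := by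
    rw [← sq_abs (s / 3 * _)]; gcongr; linarith
  have : (s / 3 * (α + 1 * γ)) ^ 2 + (s / 3 * (α + -1 * γ)) ^ 2 = 2 * (s / 3) ^ 2 := by
    have : (s / 3 * (α + 1 * γ)) ^ 2 + (s / 3 * (α + -1 * γ)) ^ 2
      = 2 * (s / 3) ^ 2 * (α ^ 2 + γ ^ 2) := by ring
    rw [this, hag, mul_one]
  nlinarith

/-- tangent plane estimates -/
lemma fs_tangent {y x : E 4} {C : Set (E 4)} (h : IsKPCone (le_refl 4) y C) (hx : x ∈ C)
    {ρ : ℝ} (hρ : 0 < ρ) (hxy : dist x y = ρ) :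
    ∃ n : E 4, ‖n‖ = 1 ∧ (∀ p ∈ C, |⟪n, p - x⟫| ≤ dist p x ^ 2 / (2 * ρ)) ∧
      ∀ z : E 4, ‖z‖ ≤ ρ / 4 → ⟪n, z⟫ = 0 → ∃ p ∈ C, dist p (x + z) ≤ 3 * ‖z‖ ^ 2 / ρ := by
  obtain ⟨e, he, hpos, hC⟩ := fs_axis_pos (x := x) h
  have hx' := (hC x).1 hx
  have hnx : ‖x - y‖ = ρ := by rw [← dist_eq_norm, hxy]
  set z0 := x - y with hz0
  set t := ⟪e, z0⟫ with ht
  have hN : ‖z0 - (2 * t) • e‖ ^ 2 = ρ ^ 2 := by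
    rw [norm_sub_sq_real, real_inner_smul_right, norm_smul, he, real_inner_comm, ← ht, mul_one,
      Real.norm_eq_abs, sq_abs, hnx]; ring
  have hN' : ‖z0 - (2 * t) • e‖ = ρ := by
    rw [sq_eq_sq₀ (norm_nonneg _) hρ.le] at hN; exact hN
  rw [hnx] at hx'
  have hees : ∀ z : E 4, 2 * ⟪e, z⟫ ^ 2 ≤ 2 * ‖z‖ ^ 2 := by
    intro z
    have := abs_real_inner_le_norm e z
    rw [he, one_mul] at this
    have h2 : |⟪e, z⟫| ^ 2 ≤ ‖z‖ ^ 2 := by gcongr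
    rw [sq_abs] at h2; linarith
  have hNz : ∀ z : E 4, ⟪ρ⁻¹ • (z0 - (2 * t) • e), z⟫ = ρ⁻¹ * (⟪z0, z⟫ - 2 * t * ⟪e, z⟫) := by
    intro z; rw [real_inner_smul_left, inner_sub_left, real_inner_smul_left]
  refine ⟨ρ⁻¹ • (z0 - (2 * t) • e), ?_, ?_, ?_⟩
  · rw [norm_smul, hN', norm_inv, Real.norm_eq_abs, abs_of_pos hρ, inv_mul_cancel₀ hρ.ne']
  · intro p hp
    have hp' := (hC p).1 hp
    have h1 : p - y = z0 + (p - x) := by rw [hz0]; abel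
    rw [h1, inner_add_right, norm_add_sq_real, ← ht, hnx] at hp'
    rw [hNz, dist_eq_norm]
    have h2 := hees (p - x)
    rw [abs_mul, abs_inv, abs_of_pos hρ, inv_mul_le_iff₀ hρ]
    have h3 : ρ * (‖p - x‖ ^ 2 / (2 * ρ)) = ‖p - x‖ ^ 2 / 2 := by field_simp
    rw [h3, abs_le]
    constructor <;> nlinarith [sq_nonneg ⟪e, p - x⟫]
  · intro z hz hz0'
    rw [hNz, mul_eq_zero, or_iff_right (by positivity)] at hz0'
    set a := ⟪e, z0 + z⟫ with ha
    have ha' : a = t + ⟪e, z⟫ := by rw [ha, inner_add_right]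
    have hZ : ‖z0 + z‖ ^ 2 = ρ ^ 2 + 2 * ⟪z0, z⟫ + ‖z‖ ^ 2 := by rw [norm_add_sq_real, hnx]
    have hez : |⟪e, z⟫| ≤ ‖z‖ := by simpa [he] using abs_real_inner_le_norm e z
    have hd : |2 * a ^ 2 - ‖z0 + z‖ ^ 2| ≤ ‖z‖ ^ 2 := by
      have h2 := hees z
      rw [hZ, ha', abs_le]
      constructor <;> nlinarith [sq_nonneg ⟪e, z⟫]
    have hge : a ^ 2 ≤ ‖z0 + z‖ ^ 2 := by linarith [hees (z0 + z)]
    have ht07 : 0.7 * ρ ≤ t := by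
      apply le_of_sq_le_sq _ hpos
      nlinarith
    have ha4 : ρ / 3 ≤ a := by
      rw [ha']; have := (abs_le.1 hez).1; linarith
    set q := Real.sqrt (‖z0 + z‖ ^ 2 - a ^ 2) with hq
    have hq0 : 0 ≤ q := Real.sqrt_nonneg _
    have hqs : q ^ 2 = ‖z0 + z‖ ^ 2 - a ^ 2 := Real.sq_sqrt (by linarith)
    refine ⟨x + z + (q - a) • e, (hC _).2 ?_, ?_⟩
    · have h1 : x + z + (q - a) • e - y = (z0 + z) + (q - a) • e := by rw [hz0]; abel
      rw [h1, inner_add_right, ← ha, real_inner_smul_right, real_inner_self_eq_norm_sq, he,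
        norm_add_sq_real, real_inner_smul_right, real_inner_comm, ← ha, norm_smul, he,
        mul_one, Real.norm_eq_abs, sq_abs]
      linear_combination hqs
    · rw [dist_eq_norm, add_sub_cancel_left, norm_smul, he, mul_one, Real.norm_eq_abs,
        le_div_iff₀ hρ]
      have h5 : (q - a) * (q + a) = -(2 * a ^ 2 - ‖z0 + z‖ ^ 2) := by linear_combination hqs
      have h6 : |q - a| * (q + a) ≤ ‖z‖ ^ 2 := by
        rw [← abs_of_nonneg (by linarith : 0 ≤ q + a), ← abs_mul, h5, abs_neg]; exact hd
      have h7 := abs_nonneg (q - a)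
      nlinarith

/-- one step -/
lemma fs_step {S C : Set (E 4)} {x y : E 4} (h : IsKPCone (le_refl 4) y C) (hx : x ∈ C)
    {s e r k : ℝ} (hs : 0 < s) (he : 0 ≤ e) (hr : 0 < r) (hk : k ≤ 1) (hk0 : 0 < k)
    (hxy : s / 2 < dist x y)
    (hSC : ∀ a ∈ S, dist a x ≤ s → ∃ b ∈ C, dist b x ≤ s ∧ dist a b ≤ e)
    (hCS : ∀ a ∈ C, dist a x ≤ s → ∃ b ∈ S, dist b x ≤ s ∧ dist a b ≤ e)
    (he2 : e ≤ k / 2 * r) (hrs : r ≤ k / 48 * s) :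
    ∃ n : E 4, ‖n‖ = 1 ∧ (∀ a ∈ S, dist a x ≤ r → |⟪n, a - x⟫| ≤ 2 * k * r) ∧
     ∀ q : E 4, dist q x ≤ r → ⟪n, q - x⟫ = 0 → ∃ b ∈ S, dist b x ≤ r ∧ dist q b ≤ 2 * k * r := by
  obtain ⟨n, hn, h1, h2⟩ := fs_tangent h hx (ρ := dist x y) (by linarith) rfl
  set ρ := dist x y with hρ
  have hρ0 : 0 < ρ := by linarith
  have her : e ≤ r := by nlinarith
  have hks : k / 48 * s ≤ s / 48 := by nlinarith
  have hquad : 12 * r ^ 2 / ρ ≤ k / 2 * r := by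
    rw [div_le_iff₀ hρ0]; nlinarith
  refine ⟨n, hn, ?_, ?_⟩
  · intro a ha hax
    obtain ⟨c, hc, -, hac⟩ := hSC a ha (by linarith)
    have h3 := h1 c hc
    have hcx : dist c x ≤ 2 * r := by
      have := dist_triangle c a x
      rw [dist_comm c a] at this; linarith
    have h4 : dist c x ^ 2 / (2 * ρ) ≤ 12 * r ^ 2 / ρ := by
      rw [div_le_div_iff₀ (by positivity) hρ0]
      have : dist c x ^ 2 ≤ (2 * r) ^ 2 := by gcongr
      nlinarith [mul_nonneg hρ0.le (sq_nonneg r)]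
    have h5 : |⟪n, a - c⟫| ≤ e := by
      refine (abs_real_inner_le_norm n _).trans ?_
      rw [hn, one_mul, ← dist_eq_norm]; exact hac
    have h6 : a - x = (a - c) + (c - x) := by abel
    rw [h6, inner_add_right]
    have := abs_add_le ⟪n, a - c⟫ ⟪n, c - x⟫
    nlinarith
  · intro q hqx hq
    have hqn : ‖q - x‖ ≤ r := by rwa [← dist_eq_norm]
    have hzn : ‖(1 - k) • (q - x)‖ = (1 - k) * ‖q - x‖ := by
      rw [norm_smul, Real.norm_eq_abs, abs_of_nonneg (by linarith)]
    have hz1 : ‖(1 - k) • (q - x)‖ ≤ (1 - k) * r := by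
      rw [hzn]; gcongr
    have hz2 : ‖(1 - k) • (q - x)‖ ≤ r := by nlinarith
    obtain ⟨p, hp, hpd⟩ := h2 ((1 - k) • (q - x)) (by linarith) (by
      rw [real_inner_smul_right, hq, mul_zero])
    have hp2 : dist p (x + (1 - k) • (q - x)) ≤ k / 2 * r := by
      refine hpd.trans (le_trans ?_ hquad)
      gcongr
      norm_num
    have hzx : dist (x + (1 - k) • (q - x)) x ≤ (1 - k) * r := by
      rw [dist_eq_norm, add_sub_cancel_left]; exact hz1
    have hqz : dist q (x + (1 - k) • (q - x)) ≤ k * r := by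
      have : q - (x + (1 - k) • (q - x)) = k • (q - x) := by module
      rw [dist_eq_norm, this, norm_smul, Real.norm_eq_abs, abs_of_pos hk0]
      gcongr
    have hpx : dist p x ≤ r := by
      have := dist_triangle p (x + (1 - k) • (q - x)) x
      nlinarith
    obtain ⟨b, hb, -, hpb⟩ := hCS p hp (by linarith)
    refine ⟨b, hb, ?_, ?_⟩
    · have t1 := dist_triangle b p x
      have t2 := dist_triangle p (x + (1 - k) • (q - x)) x
      rw [dist_comm b p] at t1
      nlinarith
    · have t1 := dist_triangle q (x + (1 - k) • (q - x)) b
      have t2 := dist_triangle (x + (1 - k) • (q - x)) p b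
      rw [dist_comm _ p] at t2
      nlinarith

/-- Corollary 3.10 / `FlatSides`: quantitative flatness of the support of
a `3`-asymptotically optimally doubling measure on `ℝ⁴` at points near a nonflat point. -/
theorem flat_sides_of_aod_support (δ : ℝ) (hδ : 0 < δ) :
    ∃ ε η A : ℝ, 0 < ε ∧ 0 < η ∧ 0 < A ∧
      ∀ μ : Measure (E 4), IsLocallyFiniteMeasure μ → AOD 3 μ →
      ∀ S : Set (E 4), S = msupp μ → (0 : E 4) ∈ S →
      ¬ Tendsto (fun r : ℝ => thetaP 3 S 0 r) (nhdsWithin 0 (Set.Ioi 0)) (nhds 0) →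
      ∀ r₀ : ℝ, 0 < r₀ →
      (∀ x ∈ S ∩ closedBall (0 : E 4) r₀, ∀ r : ℝ, 0 < r → r ≤ r₀ →
        varthetaC (le_refl 4) S x r < ε) →
      (∀ r : ℝ, 0 < r → r ≤ r₀ → thetaC (le_refl 4) S 0 r < η) →
      ∀ x ∈ S ∩ closedBall (0 : E 4) (2 * r₀ / 3), x ≠ 0 →
        ∀ r : ℝ, 0 < r → r < ‖x‖ / A → thetaP 3 S x r < δ := by
  set k : ℝ := min δ (1 / 20) / 4 with hk
  have hk0 : 0 < k := by positivity
  have hkδ : 2 * k < δ := by have := min_le_left δ (1 / 20); linarith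
  have hkb : 2 * k ≤ 1 / 20 := by have := min_le_right δ (1 / 20); linarith
  set τ : ℝ := k / 48 with hτ
  have hτ0 : 0 < τ := by positivity
  have hτ1 : τ < 1 := by linarith
  refine ⟨k / 2 * τ ^ 2, 1 / 12000, 100 / τ, by positivity, by norm_num, by positivity, ?_⟩
  intro μ _ _ S _ h0S _ r₀ hr₀ hvar hth x hx hx0 r hr hrA
  have hxpos : 0 < ‖x‖ := norm_pos_iff.2 hx0
  have hxr : ‖x‖ ≤ 2 * r₀ / 3 := by simpa using hx.2
  have hxr0 : x ∈ S ∩ closedBall (0 : E 4) r₀ := ⟨hx.1, by simp; linarith⟩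
  have hε : k / 2 * τ ^ 2 ≤ 1 / 20 := by nlinarith
  -- one step of the induction
  have step : ∀ s : ℝ, 0 < s → s ≤ r₀ →
      (∃ n : E 4, ‖n‖ = 1 ∧ ∀ a ∈ S, dist a x ≤ s → |⟪n, a - x⟫| ≤ 1 / 20 * s) →
      ∀ r : ℝ, τ ^ 2 * s ≤ r → r ≤ τ * s → ∃ n : E 4, ‖n‖ = 1 ∧
        (∀ a ∈ S, dist a x ≤ r → |⟪n, a - x⟫| ≤ 2 * k * r) ∧
        ∀ q : E 4, dist q x ≤ r → ⟪n, q - x⟫ = 0 →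
          ∃ b ∈ S, dist b x ≤ r ∧ dist q b ≤ 2 * k * r := by
    rintro s hs hsr ⟨n, hn, hflat⟩ r hr1 hr2
    have hr : 0 < r := lt_of_lt_of_le (by positivity) hr1
    have hv := hvar x hxr0 s hs hsr
    unfold varthetaC at hv
    have : Nonempty {C : Set (E 4) // (∃ y, IsKPCone (le_refl 4) y C) ∧ x ∈ C} := by
      refine ⟨⟨{p | p - x ∈ stdKP 4 (le_refl 4)}, ⟨x, LinearIsometryEquiv.refl ℝ _, ?_⟩, ?_⟩⟩
      · ext z; simp
      · simp [stdKP]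
    obtain ⟨⟨C, ⟨y, hy⟩, hxC⟩, hD⟩ := exists_lt_of_ciInf_lt hv
    have hSC := fs_exists_near hs hxC ((le_max_left _ _).trans_lt hD)
    have hCS := fs_exists_near hs hx.1 ((le_max_right _ _).trans_lt hD)
    have hfar : s / 2 < dist x y := by
      refine fs_vertex_far hy hs (b := 1 / 10) (by norm_num) hn ?_
      intro c hc hcx
      obtain ⟨a, ha, hax, hca⟩ := hCS c hc hcx
      have h5 : |⟪n, c - a⟫| ≤ 1 / 20 * s := by
        refine (abs_real_inner_le_norm n _).trans ?_
        rw [hn, one_mul, ← dist_eq_norm]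
        nlinarith
      have h6 : c - x = (c - a) + (a - x) := by abel
      rw [h6, inner_add_right]
      have := abs_add_le ⟪n, c - a⟫ ⟪n, a - x⟫
      have := hflat a ha hax
      linarith
    refine fs_step hy hxC hs (e := k / 2 * τ ^ 2 * s) (by positivity) hr (by linarith) hk0 hfar
      ?_ ?_ ?_ hr2
    · intro a ha hax
      obtain ⟨b, hb, h1, h2⟩ := hSC a ha hax
      exact ⟨b, hb, h1, h2.le⟩
    · intro a ha hax
      obtain ⟨b, hb, h1, h2⟩ := hCS a ha hax
      exact ⟨b, hb, h1, h2.le⟩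
    · rw [mul_assoc]; gcongr
  -- base scale
  have base : ∃ n : E 4, ‖n‖ = 1 ∧
      ∀ a ∈ S, dist a x ≤ ‖x‖ / 100 → |⟪n, a - x⟫| ≤ 1 / 20 * (‖x‖ / 100) := by
    have hR : 0 < 3 / 2 * ‖x‖ := by positivity
    have hv := hth (3 / 2 * ‖x‖) hR (by linarith)
    unfold thetaC at hv
    have : Nonempty {C : Set (E 4) // IsKPCone (le_refl 4) 0 C} := by
      refine ⟨⟨stdKP 4 (le_refl 4), LinearIsometryEquiv.refl ℝ _, ?_⟩⟩
      ext z; simp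
    obtain ⟨⟨C, hC⟩, hD⟩ := exists_lt_of_ciInf_lt hv
    have h0C : (0 : E 4) ∈ C := by
      obtain ⟨e, w, -, -, -, h⟩ := fs_axis hC
      exact (h 0).2 (by simp)
    have hSC := fs_exists_near hR h0C ((le_max_left _ _).trans_lt hD)
    obtain ⟨x', hx'C, -, hxx'⟩ := hSC x hx.1 (by simp; linarith)
    have hx'n : 0.9 * ‖x‖ ≤ dist x' 0 := by
      have := dist_triangle x x' 0
      rw [dist_zero_right x] at this
      linarith
    obtain ⟨n, hn, h1, -⟩ := fs_tangent hC hx'C (ρ := dist x' 0) (by linarith) rfl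
    refine ⟨n, hn, ?_⟩
    intro a ha hax
    obtain ⟨c, hc, -, hac⟩ := hSC a ha (by
      have := dist_triangle a x 0
      rw [dist_zero_right x] at this
      linarith)
    have hin : ∀ u v : E 4, |⟪n, u - v⟫| ≤ dist u v := by
      intro u v
      refine (abs_real_inner_le_norm n _).trans ?_
      rw [hn, one_mul, ← dist_eq_norm]
    have e1 := hin a c
    have e2 := hin x' x
    rw [dist_comm x' x] at e2
    have hcx : dist c x' ≤ ‖x‖ / 80 := by
      have t1 := dist_triangle c a x'
      have t2 := dist_triangle a x x'
      rw [dist_comm c a] at t1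
      linarith
    have e3 : |⟪n, c - x'⟫| ≤ ‖x‖ / 8000 := by
      refine (h1 c hc).trans ?_
      rw [div_le_iff₀ (by linarith)]
      have : dist c x' ^ 2 ≤ (‖x‖ / 80) ^ 2 := by gcongr
      nlinarith
    have h6 : a - x = (a - c) + (c - x') + (x' - x) := by abel
    rw [h6, inner_add_right, inner_add_right]
    have := abs_add_three ⟪n, a - c⟫ ⟪n, c - x'⟫ ⟪n, x' - x⟫
    linarith
  have ind : ∀ j : ℕ, ∃ n : E 4, ‖n‖ = 1 ∧ ∀ a ∈ S, dist a x ≤ τ ^ j * (‖x‖ / 100) →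
      |⟪n, a - x⟫| ≤ 1 / 20 * (τ ^ j * (‖x‖ / 100)) := by
    intro j
    induction j with
    | zero => simpa using base
    | succ j ih =>
      have hle : τ ^ j * (‖x‖ / 100) ≤ r₀ := by
        have : τ ^ j ≤ 1 := pow_le_one₀ hτ0.le hτ1.le
        nlinarith
      obtain ⟨n, hn, h1, -⟩ := step _ (by positivity) hle ih (τ ^ (j + 1) * (‖x‖ / 100))
        (by
          have : τ * (τ * (τ ^ j * (‖x‖ / 100))) ≤ 1 * (τ * (τ ^ j * (‖x‖ / 100))) := by
            gcongr
          calc _ = τ * (τ * (τ ^ j * (‖x‖ / 100))) := by ring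
            _ ≤ _ := this
            _ = _ := by ring)
        (by rw [pow_succ]; apply le_of_eq; ring)
      refine ⟨n, hn, fun a ha hax => (h1 a ha hax).trans ?_⟩
      gcongr
  have hrτ : r / (τ * (‖x‖ / 100)) ≤ 1 := by
    rw [div_le_one (by positivity)]
    have : ‖x‖ / (100 / τ) = τ * (‖x‖ / 100) := by field_simp
    linarith
  obtain ⟨j, hj1, hj2⟩ := exists_nat_pow_near_of_lt_one (x := r / (τ * (‖x‖ / 100)))
    (by positivity) hrτ hτ0 hτ1
  rw [lt_div_iff₀ (by positivity)] at hj1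
  rw [div_le_iff₀ (by positivity)] at hj2
  have hle : τ ^ j * (‖x‖ / 100) ≤ r₀ := by
    have : τ ^ j ≤ 1 := pow_le_one₀ hτ0.le hτ1.le
    nlinarith
  obtain ⟨n, hn, h1, h2⟩ := step _ (by positivity) hle (ind j) r
    (by
      have : τ ^ 2 * (τ ^ j * (‖x‖ / 100)) = τ ^ (j + 1) * (τ * (‖x‖ / 100)) := by ring
      linarith)
    (by
      have : τ * (τ ^ j * (‖x‖ / 100)) = τ ^ j * (τ * (‖x‖ / 100)) := by ring
      linarith)
  exact (fs_thetaP_le hr (by positivity) hn h1 h2).trans_lt hkδ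
end
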